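/- arXiv:math/0410406 — 3 statements merged into one kernel-verified Lean document; each statement's English description precedes it below -/
import Mathlib

section
/- Let X be an infinite set of cardinality κ = ℵ_α and λ = max(|α|, ℵ₀). Then there is an order embedding from the power set of 2^λ (ordered by inclusion) into the lattice of submonoids of O^(1) containing the permutations S (i.e., into the interval [S, O^(1)], ordered by inclusion). In particular there exist at least 2^(2^λ) submonoids of O^(1) containing S. -/
open Cardinal

universe u

/-- The submonoid of all permutations inside the full transformation monoid `Function.End X`. -/
def permSubmonoid (X : Type u) : Submonoid (Function.End X) where
  carrier := {f | Function.Bijective f}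
  mul_mem' hf hg := hf.comp hg
  one_mem' := Function.bijective_id

/-- A submonoid `C ≠ O⁽¹⁾` is precomplete iff together with any function outside of it,
it generates the full transformation monoid. -/
def Precomplete {X : Type u} (C : Submonoid (Function.End X)) : Prop :=
  C ≠ ⊤ ∧ ∀ f : Function.End X, f ∉ C →
    Submonoid.closure ((C : Set (Function.End X)) ∪ {f}) = ⊤

/-- `f` is `ξ`-injective: `f` is injective off a set of cardinality `< ξ`. -/
def XiInjective {X : Type u} (ξ : Cardinal.{u}) (f : Function.End X) : Prop :=
  ∃ Y : Set X, #Y < ξ ∧ Set.InjOn f Yᶜ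

/-- `f` is `ξ`-surjective: the complement of its range has cardinality `< ξ`. -/
def XiSurjective {X : Type u} (ξ : Cardinal.{u}) (f : Function.End X) : Prop :=
  #((Set.range f)ᶜ : Set X) < ξ

/-- The set `A` of functions almost all of whose fibers are small. -/
def monA (X : Type u) : Set (Function.End X) :=
  {f | #{y : X | ¬ #(f ⁻¹' {y}) < #X} < #X}

/-- The set `A'` of functions `f` such that for some `ξ < |X|`, almost all fibers of `f`
have cardinality at most `ξ`. -/
def monA' (X : Type u) : Set (Function.End X) :=
  {f | ∃ ξ : Cardinal.{u}, ξ < #X ∧ #{x : X | ¬ #(f ⁻¹' {x}) ≤ ξ} < #X}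

/-- The set `G_ξ` of functions which are `ξ`-injective or not `ξ`-surjective. -/
def monG (X : Type u) (ξ : Cardinal.{u}) : Set (Function.End X) :=
  {f | XiInjective ξ f ∨ ¬ XiSurjective ξ f}

/-- The set `M_ξ` of functions which are `ξ`-surjective or not `ξ`-injective. -/
def monM (X : Type u) (ξ : Cardinal.{u}) : Set (Function.End X) :=
  {f | XiSurjective ξ f ∨ ¬ XiInjective ξ f}

/-- The kernel sequence of `f` assigns to every cardinal `ξ` the number of
(nonempty) fibers of `f` of cardinality `ξ`. -/
noncomputable def kernelSeq {X : Type u} (f : X → X) (ξ : Cardinal.{u}) : Cardinal.{u} :=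
  #{A : Set X // (∃ y : X, A = f ⁻¹' {y}) ∧ A.Nonempty ∧ #A = ξ}

/-- The set `R`: the range of the sequence `(n i)` together with all infinite
successor cardinals `≤ κ`. -/
def setR (κ : Cardinal.{u}) (n : ℕ → ℕ) : Set Cardinal.{u} :=
  (Set.range fun i : ℕ => (n i : Cardinal.{u})) ∪
    {ξ | ℵ₀ ≤ ξ ∧ ξ ≤ κ ∧ ∃ μ : Cardinal.{u}, ξ = Order.succ μ}

/-- The sum of a set of cardinals. -/
noncomputable def setSum (A : Set Cardinal.{u}) : Cardinal.{u + 1} :=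
  Cardinal.sum fun η : A => (η : Cardinal.{u})

/-- The cardinality of the fiber of `f` through `x`. -/
def fiberCard {Y Z : Type u} (f : Y → Z) (x : Y) : Cardinal.{u} :=
  #{x' : Y // f x' = f x}

/-- The number of points lying in a nontrivial fiber of `f` of cardinality at most `ξ`. -/
def fiberWeight {Y Z : Type u} (f : Y → Z) (ξ : Cardinal.{u}) : Cardinal.{u} :=
  #{x : Y // 1 < fiberCard f x ∧ fiberCard f x ≤ ξ}

theorem fiberCard_eq_one_of_injective {Y Z : Type u} {f : Y → Z} (hf : Function.Injective f)
    (x : Y) : fiberCard f x = 1 := by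
  have : Unique {x' : Y // f x' = f x} :=
    ⟨⟨⟨x, rfl⟩⟩, fun y => Subtype.ext (hf y.2)⟩
  exact Cardinal.mk_eq_one _

theorem fiberWeight_eq_zero_of_injective {Y Z : Type u} {f : Y → Z}
    (hf : Function.Injective f) (ξ : Cardinal.{u}) : fiberWeight f ξ = 0 := by
  rw [fiberWeight, Cardinal.mk_eq_zero_iff]
  refine ⟨fun x => ?_⟩
  have := x.2.1
  rw [fiberCard_eq_one_of_injective hf] at this
  exact lt_irrefl _ this

theorem fiberCard_le_comp_right {Y Z W : Type u} (f : Z → W) (g : Y → Z) (x : Y) :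
    fiberCard g x ≤ fiberCard (f ∘ g) x :=
  Cardinal.mk_le_of_injective
    (f := fun y => (⟨y.1, congrArg f y.2⟩ : {x' // (f ∘ g) x' = (f ∘ g) x}))
    fun _ _ h => Subtype.ext (congrArg (fun t => t.1) h)

theorem fiberCard_le_comp_left {Y Z W : Type u} (f : Z → W) {g : Y → Z}
    (hg : Function.Surjective g) (x : Y) :
    fiberCard f (g x) ≤ fiberCard (f ∘ g) x := by
  refine Cardinal.mk_le_of_surjective
    (f := fun y : {x' // (f ∘ g) x' = (f ∘ g) x} =>
      (⟨g y.1, y.2⟩ : {z // f z = f (g x)})) fun z => ?_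
  obtain ⟨y, hy⟩ := hg z.1
  refine ⟨⟨y, ?_⟩, Subtype.ext hy⟩
  simp only [Function.comp_apply, hy]
  exact z.2

theorem eq_of_fiberCard_le_one {Y Z : Type u} {f : Y → Z} {x y : Y}
    (h : fiberCard f x ≤ 1) (hy : f y = f x) : y = x := by
  have := Cardinal.le_one_iff_subsingleton.1 h
  exact congrArg Subtype.val
    (Subsingleton.elim (⟨y, hy⟩ : {x' : Y // f x' = f x}) ⟨x, rfl⟩)

theorem fiberWeight_comp_le {Y Z W : Type u} (f : Z → W) {g : Y → Z}
    (hg : Function.Surjective g) (ξ : Cardinal.{u}) :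
    fiberWeight (f ∘ g) ξ ≤ fiberWeight f ξ + fiberWeight g ξ := by
  classical
  have hlt : ∀ x, 1 < fiberCard (f ∘ g) x → ¬ 1 < fiberCard g x → 1 < fiberCard f (g x) := by
    intro x h1 h2
    by_contra h3
    have : fiberCard (f ∘ g) x ≤ 1 := by
      refine Cardinal.le_one_iff_subsingleton.2 ⟨fun a b => Subtype.ext ?_⟩
      have key : ∀ c : {x' // (f ∘ g) x' = (f ∘ g) x}, c.1 = x := fun c =>
        eq_of_fiberCard_le_one (not_lt.1 h2) (eq_of_fiberCard_le_one (not_lt.1 h3) c.2)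
      rw [key a, key b]
    exact absurd h1 (not_lt.2 this)
  rw [fiberWeight, fiberWeight, fiberWeight, Cardinal.add_def]
  refine Cardinal.mk_le_of_injective (f := fun x =>
    if h : 1 < fiberCard g x.1 then
      Sum.inr ⟨x.1, h, (fiberCard_le_comp_right f g _).trans x.2.2⟩
    else Sum.inl ⟨g x.1, hlt _ x.2.1 h, (fiberCard_le_comp_left f hg _).trans x.2.2⟩) ?_
  intro x y hxy
  by_cases hx : 1 < fiberCard g x.1 <;> by_cases hy : 1 < fiberCard g y.1 <;>
    simp only [hx, hy, dite_true, dite_false, Sum.inr.injEq, Sum.inl.injEq, Subtype.mk.injEq,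
      reduceCtorEq] at hxy
  · exact Subtype.ext hxy
  · exact Subtype.ext (eq_of_fiberCard_le_one (not_lt.1 hy) hxy)

/-- There is a surjection of `X` whose nontrivial fibers have exactly the sizes `n d`, `d ∈ A`. -/
theorem exists_surjective_fiberWeight {X D : Type u} [Infinite X] {n : D → Cardinal.{u}}
    (hn : Function.Injective n) (hn1 : ∀ d, 1 < n d) (hsum : Cardinal.sum n ≤ #X) (A : Set D) :
    ∃ f : X → X, Function.Surjective f ∧ (∀ d ∈ A, n d ≤ fiberWeight f (n d)) ∧
      ∀ d ∉ A, fiberWeight f (n d) ≤ Cardinal.sum fun d' : {d' // n d' < n d} => n d' := by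
  have hX : ℵ₀ ≤ #X := Cardinal.aleph0_le_mk X
  have hne : ∀ d, Nonempty (n d).out := fun d => by
    rw [← Cardinal.mk_ne_zero_iff, Cardinal.mk_out]
    exact (zero_lt_one.trans (hn1 d)).ne'
  have hS : #(Σ d : A, (n d).out) ≤ #X := by
    refine (Cardinal.mk_le_of_injective (f := fun p : (Σ d : A, (n d).out) =>
      (⟨p.1.1, p.2⟩ : Σ d : D, (n d).out)) ?_).trans ((by simp : _ = _).trans_le hsum)
    rintro ⟨⟨a, ha⟩, x⟩ ⟨⟨b, hb⟩, y⟩ h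
    simp only [Sigma.mk.injEq] at h
    obtain ⟨rfl, h⟩ := h
    rw [eq_of_heq h]
  have hA : #A ≤ #X := by
    refine le_trans (Cardinal.mk_le_of_surjective (f := fun p : (Σ d : A, (n d).out) => p.1) ?_) hS
    intro d
    exact ⟨⟨d, Classical.arbitrary _⟩, rfl⟩
  obtain ⟨e₁⟩ : Nonempty (X ≃ X ⊕ Σ d : A, (n d).out) := by
    rw [← Cardinal.eq, Cardinal.mk_sum, Cardinal.lift_id, Cardinal.lift_id,
      Cardinal.add_eq_left hX hS]
  obtain ⟨e₂⟩ : Nonempty (X ⊕ A ≃ X) := by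
    rw [← Cardinal.eq, Cardinal.mk_sum, Cardinal.lift_id, Cardinal.lift_id,
      Cardinal.add_eq_left hX hA]
  let p : (X ⊕ Σ d : A, (n d).out) → X ⊕ A := Sum.map id Sigma.fst
  have hinl : ∀ x, fiberCard (e₂ ∘ p ∘ e₁) (e₁.symm (Sum.inl x)) ≤ 1 := by
    intro x
    refine Cardinal.le_one_iff_subsingleton.2 ⟨fun a b => Subtype.ext ?_⟩
    have key : ∀ c : {x' // (e₂ ∘ p ∘ e₁) x' = (e₂ ∘ p ∘ e₁) (e₁.symm (Sum.inl x))},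
        c.1 = e₁.symm (Sum.inl x) := by
      rintro ⟨c, hc⟩
      obtain ⟨c, rfl⟩ := e₁.symm.surjective c
      rcases c with c | c
      · simpa [p] using hc
      · simp [p] at hc
    rw [key a, key b]
  have hinr : ∀ d : A, ∀ q, fiberCard (e₂ ∘ p ∘ e₁) (e₁.symm (Sum.inr ⟨d, q⟩)) = n d := by
    intro d q
    rw [← Cardinal.mk_out (n d), fiberCard, eq_comm]
    refine Cardinal.mk_congr (Equiv.ofBijective
      (fun r => ⟨e₁.symm (Sum.inr ⟨d, r⟩), by simp [p]⟩) ⟨fun r s h => ?_, ?_⟩)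
    · simpa using h
    · rintro ⟨c, hc⟩
      obtain ⟨c, rfl⟩ := e₁.symm.surjective c
      rcases c with c | ⟨d', r⟩ <;>
        simp only [p, Function.comp_apply, Equiv.apply_symm_apply, Sum.map_inl, Sum.map_inr,
          id, EmbeddingLike.apply_eq_iff_eq, Sum.inr.injEq, reduceCtorEq] at hc
      subst hc
      exact ⟨r, rfl⟩
  refine ⟨e₂ ∘ p ∘ e₁, ?_, fun d hd => ?_, fun d hd => ?_⟩
  · refine e₂.surjective.comp (Function.Surjective.comp ?_ e₁.surjective)
    rintro (x | d)
    · exact ⟨Sum.inl x, rfl⟩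
    · exact ⟨Sum.inr ⟨d, Classical.arbitrary _⟩, rfl⟩
  · rw [fiberWeight]
    conv_lhs => rw [← Cardinal.mk_out (n d)]
    refine Cardinal.mk_le_of_injective (f := fun r => ⟨e₁.symm (Sum.inr ⟨⟨d, hd⟩, r⟩), ?_⟩) ?_
    · rw [hinr]
      exact ⟨hn1 d, le_rfl⟩
    · intro r s h
      simpa using h
  · have h2 : (Cardinal.sum fun d' : {d' // n d' < n d} => n d') =
        #(Σ d' : {d' // n d' < n d}, (n d').out) := by simp
    rw [h2]
    have hcode : ∀ x : {x // 1 < fiberCard (e₂ ∘ p ∘ e₁) x ∧ fiberCard (e₂ ∘ p ∘ e₁) x ≤ n d},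
        ∃ s : (Σ d' : {d' // n d' < n d}, (n d').out), ∃ h : s.1.1 ∈ A,
          x.1 = e₁.symm (Sum.inr ⟨⟨s.1.1, h⟩, s.2⟩) := by
      rintro ⟨x, hx1, hx2⟩
      obtain ⟨x, rfl⟩ := e₁.symm.surjective x
      rcases x with x | ⟨⟨d', hd'⟩, q⟩
      · exact absurd hx1 (not_lt.2 (hinl x))
      · rw [hinr] at hx2
        exact ⟨⟨⟨d', hx2.lt_of_ne fun h => hd (hn h ▸ hd')⟩, q⟩, hd', rfl⟩
    choose s hs hxs using hcode
    refine Cardinal.mk_le_of_injective (f := s) fun x y h => Subtype.ext ?_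
    rw [hxs x, hxs y]
    congr!

/-- A family of `2 ^ #D` subsets of `D`, none of which is almost covered by finitely many
others. -/
theorem exists_independent_family (D : Type u) [Infinite D] :
    ∃ A : Set D → Set D, ∀ (Z : Set D) (l : List (Set D)), Z ∉ l →
      {d | d ∈ A Z ∧ ∀ Z' ∈ l, d ∉ A Z'}.Infinite := by
  classical
  obtain ⟨e⟩ : Nonempty (Finset D × Finset D ≃ D) := by
    rw [← Cardinal.eq, Cardinal.mk_prod, Cardinal.lift_id, Cardinal.mk_finset_of_infinite,
      Cardinal.mul_eq_self (Cardinal.aleph0_le_mk D)]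
  refine ⟨fun Z => {d | (e.symm d).1.filter (· ∈ Z) = (e.symm d).2}, fun Z l hl => ?_⟩
  have hsep : ∃ F : Finset D, ∀ Z' ∈ l, ∃ x ∈ F, ¬ (x ∈ Z' ↔ x ∈ Z) := by
    induction l with
    | nil => exact ⟨∅, by simp⟩
    | cons W l ih =>
      obtain ⟨F, hF⟩ := ih fun h => hl (List.mem_cons_of_mem _ h)
      have hW : W ≠ Z := fun h => hl (h ▸ List.mem_cons_self)
      obtain ⟨x, hx⟩ : ∃ x, ¬ (x ∈ W ↔ x ∈ Z) := by
        by_contra! h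
        exact hW (Set.ext h)
      refine ⟨insert x F, fun Z' hZ' => ?_⟩
      rcases List.mem_cons.1 hZ' with rfl | hZ'
      · exact ⟨x, Finset.mem_insert_self _ _, hx⟩
      · obtain ⟨y, hy, h⟩ := hF Z' hZ'
        exact ⟨y, Finset.mem_insert_of_mem hy, h⟩
  obtain ⟨F, hF⟩ := hsep
  have hinf : (Set.Ici F).Infinite := Set.infinite_of_not_bddAbove fun ⟨B, hB⟩ => by
    obtain ⟨x, hx⟩ := Infinite.exists_notMem_finset B
    have : insert x F ≤ B := hB (Finset.subset_insert x F)
    exact hx (this (Finset.mem_insert_self _ _))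
  refine Set.infinite_of_injOn_mapsTo (f := fun G : Finset D => e (G, G.filter (· ∈ Z)))
    (fun _ _ _ _ h => congrArg Prod.fst (e.injective h)) (fun G hG => ?_) hinf
  refine ⟨by simp, fun Z' hZ' h => ?_⟩
  obtain ⟨x, hx, hne⟩ := hF Z' hZ'
  simp only [Set.mem_ofPred_eq, Equiv.symm_apply_apply] at h
  have hxG : x ∈ G := hG hx
  have := Finset.ext_iff.1 h x
  simp only [Finset.mem_filter, hxG, true_and] at this
  exact hne this

/-- The submonoid of surjections whose fiber weights are bounded by a finite sum of the fiber
weights of members of `F` with index different from `i`. -/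
def boundedWeightSubmonoid {X ι : Type u} (F : ι → X → X) (i : ι) :
    Submonoid (Function.End X) where
  carrier := {f | Function.Surjective f ∧ ∃ l : List ι, i ∉ l ∧
    ∀ ξ, fiberWeight f ξ ≤ (l.map fun j => fiberWeight (F j) ξ).sum}
  mul_mem' := by
    rintro f g ⟨hf, l, hl, hfl⟩ ⟨hg, l', hl', hgl⟩
    refine ⟨hf.comp hg, l ++ l', by simp [hl, hl'], fun ξ => ?_⟩
    rw [List.map_append, List.sum_append]
    exact (fiberWeight_comp_le f hg ξ).trans (add_le_add (hfl ξ) (hgl ξ))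
  one_mem' := ⟨Function.surjective_id, [], by simp, fun ξ =>
    (fiberWeight_eq_zero_of_injective Function.injective_id ξ).le.trans zero_le⟩

theorem permSubmonoid_le_boundedWeightSubmonoid {X ι : Type u} (F : ι → X → X) (i : ι) :
    permSubmonoid X ≤ boundedWeightSubmonoid F i :=
  fun _ hf => ⟨hf.2, [], by simp, fun ξ =>
    (fiberWeight_eq_zero_of_injective hf.1 ξ).le.trans zero_le⟩

theorem nonempty_orderEmbedding_of_separating {M ι : Type u} [Monoid M] (P : Submonoid M)
    (F : ι → M) (N : ι → Submonoid M) (hP : ∀ i, P ≤ N i) (hF : ∀ i j, F j ∈ N i ↔ j ≠ i) :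
    Nonempty (Set ι ↪o {Q : Submonoid M // P ≤ Q}) := by
  refine ⟨OrderEmbedding.ofMapLEIff
    (fun A => ⟨⨅ i : {i // i ∉ A}, N i, le_iInf fun i => hP i⟩) fun A B => ⟨fun h j hj => ?_,
      fun h => Subtype.mk_le_mk.2 (le_iInf fun i =>
        iInf_le (fun i : {i // i ∉ A} => N i) ⟨i.1, fun hi => i.2 (h hi)⟩)⟩⟩
  by_contra hjB
  have h1 : F j ∈ ⨅ i : {i // i ∉ A}, N i :=
    (Submonoid.mem_iInf).2 fun i => (hF _ _).2 fun h => i.2 (h ▸ hj)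
  have h2 := (Submonoid.mem_iInf).1 (h h1) ⟨j, hjB⟩
  exact (hF j j).1 h2 rfl

/-- A sparse family of cardinals indexed by `D` and with sum at most `#X` yields an embedding of
the power set of `2 ^ #D` into the monoids above the permutations. -/
theorem nonempty_orderEmbedding_of_sparse {X D : Type u} [Infinite X] [Infinite D]
    {n : D → Cardinal.{u}} (hn : Function.Injective n) (hn1 : ∀ d, 1 < n d)
    (hsum : Cardinal.sum n ≤ #X)
    (hsparse : ∀ k : ℕ,
      {d | n d ≤ k * Cardinal.sum fun d' : {d' // n d' < n d} => n d'}.Finite) :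
    Nonempty (Set (Set D) ↪o {M : Submonoid (Function.End X) // permSubmonoid X ≤ M}) := by
  obtain ⟨A, hA⟩ := exists_independent_family D
  choose F hsurj hge hle using fun Z => exists_surjective_fiberWeight hn hn1 hsum (A Z)
  refine nonempty_orderEmbedding_of_separating _ F (boundedWeightSubmonoid F)
    (permSubmonoid_le_boundedWeightSubmonoid F) fun Z Z' => ⟨?_, fun h =>
      ⟨hsurj Z', [Z'], by simpa using h.symm, by simp⟩⟩
  rintro ⟨-, l, hl, hb⟩ rfl
  obtain ⟨d, ⟨hdA, hd⟩, hdk⟩ := ((hA _ l hl).sdiff (hsparse l.length)).nonempty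
  refine hdk ((hge _ d hdA).trans ((hb (n d)).trans ?_))
  have := List.sum_le_card_nsmul (l.map fun j => fiberWeight (F j) (n d))
    (Cardinal.sum fun d' : {d' // n d' < n d} => n d') (by
      simp only [List.mem_map]
      rintro _ ⟨Z, hZ, rfl⟩
      exact hle Z d (hd Z hZ))
  simpa using this

theorem sum_le_mk_mul {ι : Type u} {f : ι → Cardinal.{u}} {c : Cardinal.{u}}
    (h : ∀ i, f i ≤ c) : Cardinal.sum f ≤ #ι * c := by
  simpa using Cardinal.sum_le_sum f (fun _ => c) h

/-- The case `λ = ℵ₀`, using the fiber sizes `((i + 2)!) ^ 2`. -/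
theorem nonempty_orderEmbedding_set_nat {X : Type u} [Infinite X] :
    Nonempty (Set (Set (ULift.{u} ℕ)) ↪o
      {M : Submonoid (Function.End X) // permSubmonoid X ≤ M}) := by
  have hlt : ∀ i j : ULift.{u} ℕ,
      (((i.down + 2).factorial ^ 2 : ℕ) : Cardinal.{u}) < ((j.down + 2).factorial ^ 2 : ℕ) ↔
        i.down < j.down := by
    intro i j
    rw [Nat.cast_lt, Nat.pow_lt_pow_iff_left two_ne_zero, Nat.factorial_lt (by omega)]
    omega
  refine nonempty_orderEmbedding_of_sparse
    (n := fun i : ULift.{u} ℕ => (((i.down + 2).factorial ^ 2 : ℕ) : Cardinal.{u}))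
    (fun i j h => ?_) (fun i => ?_) ?_ fun k => ?_
  · have h1 := (hlt i j).not.1 h.not_lt
    have h2 := (hlt j i).not.1 h.not_gt
    exact ULift.ext _ _ (by omega)
  · have : 2 ≤ (i.down + 2).factorial := Nat.self_le_factorial 2 |>.trans
      (Nat.factorial_le (by omega))
    exact_mod_cast (by nlinarith : 1 < (i.down + 2).factorial ^ 2)
  · refine (sum_le_mk_mul fun i => (Cardinal.natCast_lt_aleph0).le).trans ?_
    simp
  · refine ((Set.finite_Iio k).preimage ULift.down_injective.injOn).subset fun i hi => ?_
    rw [Set.mem_ofPred_eq] at hi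
    by_contra hik
    have hki : k ≤ i.down := not_lt.1 hik
    have hsum : (Cardinal.sum fun j : {j : ULift.{u} ℕ //
        (((j.down + 2).factorial ^ 2 : ℕ) : Cardinal.{u}) < ((i.down + 2).factorial ^ 2 : ℕ)} =>
          (((j.1.down + 2).factorial ^ 2 : ℕ) : Cardinal.{u})) ≤
        (i.down : Cardinal.{u}) * ((i.down + 1).factorial ^ 2 : ℕ) := by
      refine (sum_le_mk_mul (c := ((i.down + 1).factorial ^ 2 : ℕ)) fun j => ?_).trans ?_
      · have := (hlt _ _).1 j.2
        exact_mod_cast Nat.pow_le_pow_left (Nat.factorial_le (by omega)) 2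
      · gcongr
        have := Cardinal.mk_le_of_injective (f := fun j : {j : ULift.{u} ℕ //
            (((j.down + 2).factorial ^ 2 : ℕ) : Cardinal.{u}) <
              ((i.down + 2).factorial ^ 2 : ℕ)} =>
          (ULift.up ⟨j.1.down, (hlt _ _).1 j.2⟩ : ULift.{u} (Fin i.down))) fun _ _ h => by
            simp only [ULift.up.injEq, Fin.mk.injEq] at h
            exact Subtype.ext (ULift.ext _ _ h)
        simpa using this
    have h2 := hi.trans (mul_le_mul_right hsum (k : Cardinal.{u}))
    have h3 : (i.down + 2).factorial ^ 2 ≤ k * (i.down * (i.down + 1).factorial ^ 2) := by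
      exact_mod_cast h2
    rw [Nat.factorial_succ (i.down + 1), mul_pow, ← mul_assoc] at h3
    have h4 := Nat.le_of_mul_le_mul_right h3 (by positivity)
    nlinarith

/-- The case of infinite `α`, using the infinite successor cardinals up to `#X` as fiber sizes. -/
theorem nonempty_orderEmbedding_set_toType {X : Type u} [Infinite X] {α : Ordinal.{u}}
    (hκ : #X = ℵ_ α) (hα : Ordinal.omega0 ≤ α) :
    Nonempty (Set (Set α.ToType) ↪o
      {M : Submonoid (Function.End X) // permSubmonoid X ≤ M}) := by
  have : Infinite α.ToType := by
    rw [Cardinal.infinite_iff, Cardinal.mk_toType]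
    exact Ordinal.aleph0_le_card.2 hα
  have hlt : ∀ i j : α.ToType, Order.succ (ℵ_ (Ordinal.ToType.mk.symm i).1) <
      Order.succ (ℵ_ (Ordinal.ToType.mk.symm j).1) ↔ i < j := by
    intro i j
    simp
  refine nonempty_orderEmbedding_of_sparse
    (n := fun i : α.ToType => Order.succ (ℵ_ (Ordinal.ToType.mk.symm i).1))
    (fun i j h => ?_) (fun i => ?_) ?_ fun k => ?_
  · exact le_antisymm (not_lt.1 ((hlt j i).not.1 h.not_gt))
      (not_lt.1 ((hlt i j).not.1 h.not_lt))
  · exact (Cardinal.one_lt_aleph0.trans_le (Cardinal.aleph0_le_aleph _)).trans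
      (Order.lt_succ _)
  · refine (sum_le_mk_mul (c := ℵ_ α) fun i => Order.succ_le_of_lt
      (Cardinal.aleph_lt_aleph.2 (Ordinal.ToType.mk.symm i).2)).trans ?_
    rw [hκ, Cardinal.mk_toType]
    exact Cardinal.mul_le_of_le (Cardinal.aleph0_le_aleph _) (Ordinal.card_le_aleph α) le_rfl
  · convert Set.finite_empty
    refine Set.eq_empty_of_forall_notMem fun i hi => ?_
    have hinf := Cardinal.aleph0_le_aleph (Ordinal.ToType.mk.symm i).1
    refine absurd (hi.trans ?_) (not_le.2 (Order.lt_succ (ℵ_ (Ordinal.ToType.mk.symm i).1)))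
    refine Cardinal.mul_le_of_le hinf ((Cardinal.natCast_lt_aleph0).le.trans hinf) ?_
    refine (sum_le_mk_mul (c := ℵ_ (Ordinal.ToType.mk.symm i).1) fun j => Order.succ_le_of_lt
      (by simpa using (hlt _ _).1 j.2)).trans (Cardinal.mul_le_of_le hinf ?_ le_rfl)
    refine le_trans ?_ (Ordinal.card_le_aleph _)
    have h1 : (Ordinal.ToType.mk.symm i).1 = Ordinal.typein (α := α.ToType) (· < ·) i := rfl
    rw [h1, Ordinal.card_typein]
    exact Cardinal.mk_le_of_injective (f := fun j => ⟨j.1, (hlt _ _).1 j.2⟩)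
      fun _ _ h => Subtype.ext (congrArg (fun t => t.1) h)

/-- The power set of `2^λ` order-embeds into the lattice of submonoids of the full
transformation monoid containing the permutations; in particular there are at least
`2^(2^λ)` such submonoids. -/
theorem embedding_powerset_into_monoids_above_S {X : Type u} [Infinite X] {α : Ordinal.{u}}
    (hκ : #X = Cardinal.aleph α) (lam : Cardinal.{u}) (hlam : lam = max α.card ℵ₀) :
    Nonempty (Set (Quotient.out ((2 : Cardinal.{u}) ^ lam)) ↪o
        {M : Submonoid (Function.End X) // permSubmonoid X ≤ M}) ∧
    (2 : Cardinal.{u}) ^ ((2 : Cardinal.{u}) ^ lam) ≤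
      #{M : Submonoid (Function.End X) // permSubmonoid X ≤ M} := by
  have hmain : Nonempty (Set (Quotient.out ((2 : Cardinal.{u}) ^ lam)) ↪o
      {M : Submonoid (Function.End X) // permSubmonoid X ≤ M}) := by
    obtain ⟨D, hD, ⟨φ⟩⟩ : ∃ D : Type u, #D = lam ∧ Nonempty (Set (Set D) ↪o
        {M : Submonoid (Function.End X) // permSubmonoid X ≤ M}) := by
      rcases lt_or_ge α Ordinal.omega0 with hα | hα
      · refine ⟨ULift ℕ, ?_, nonempty_orderEmbedding_set_nat⟩
        rw [hlam, max_eq_right (Ordinal.card_lt_aleph0.2 hα).le]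
        simp
      · refine ⟨α.ToType, ?_, nonempty_orderEmbedding_set_toType hκ hα⟩
        rw [hlam, max_eq_left (Ordinal.aleph0_le_card.2 hα), Cardinal.mk_toType]
    obtain ⟨e⟩ : Nonempty (Quotient.out ((2 : Cardinal.{u}) ^ lam) ≃ Set D) := by
      rw [← Cardinal.eq, Cardinal.mk_out, Cardinal.mk_set, hD]
    exact ⟨(e.toOrderIsoSet.toOrderEmbedding).trans φ⟩
  refine ⟨hmain, ?_⟩
  obtain ⟨φ⟩ := hmain
  simpa using Cardinal.mk_le_of_injective φ.injective
end

section
/- Let κ be a singular cardinal with κ = ℵ_α and max(|α|, ℵ₀) = κ, and let R = {n_i : i ∈ ω} ∪ {ξ : ξ an infinite successor cardinal, ξ ≤ κ} for a sequence (n_i) of natural numbers with Σ_{j<i} n_j < n_i. Then there exists a family I of pairwise incomparable (i.e., A ⊄ B for all distinct A, B ∈ I) small unbounded subsets of R (each of cardinality less than κ, each with Σ_{ξ∈A} ξ = κ) such that |I| = κ^{<κ} = sup{κ^ξ : ξ a cardinal, ξ < κ}. -/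
open Cardinal

universe u

/-- A set coding the function `f : Set.Iio w → W` by the graph of `f` together with a marker
for `w`. -/
def markedGraph {W : Type u} [LinearOrder W] (x : Σ w : W, Set.Iio w → W) : Set (W ⊕ W × W) :=
  insert (Sum.inl x.1) (Set.range fun i : Set.Iio x.1 => Sum.inr (i.1, x.2 i))

theorem eq_of_markedGraph_subset {W : Type u} [LinearOrder W] {x y : Σ w : W, Set.Iio w → W}
    (h : markedGraph x ⊆ markedGraph y) : x = y := by
  obtain ⟨v, f⟩ := x
  obtain ⟨w, g⟩ := y
  have hvw : v = w := by
    simpa [markedGraph] using h (Set.mem_insert _ _)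
  subst hvw
  congr
  funext i
  obtain ⟨j, hj⟩ : Sum.inr (i.1, f i) ∈ Set.range fun i : Set.Iio v =>
      (Sum.inr (i.1, g i) : W ⊕ W × W) := by
    simpa [markedGraph] using h (Set.mem_insert_of_mem _ ⟨i, rfl⟩)
  have hj' := Prod.ext_iff.1 (Sum.inr_injective hj)
  obtain rfl : j = i := Subtype.ext hj'.1
  exact hj'.2.symm

theorem mk_markedGraph_lt {κ : Cardinal.{u}} (hκ : ℵ₀ ≤ κ)
    (x : Σ w : κ.ord.ToType, Set.Iio w → κ.ord.ToType) : #(markedGraph x) < κ :=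
  mk_insert_le.trans_lt <| add_lt_of_lt hκ (mk_range_le.trans_lt (by simpa using mk_Iio_lt x.1))
    (one_lt_aleph0.trans_le hκ)

theorem mk_sigma_Iio_arrow {κ : Cardinal.{u}} (hκ : ℵ₀ ≤ κ) :
    #(Σ w : κ.ord.ToType, Set.Iio w → κ.ord.ToType) = κ ^< κ := by
  have hle : κ ≤ κ ^< κ := by
    simpa using le_powerlt κ (one_lt_aleph0.trans_le hκ)
  rw [mk_sigma]
  apply le_antisymm
  · calc
      _ ≤ sum fun _ : κ.ord.ToType => κ ^< κ := sum_le_sum _ _ fun w => by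
          simpa using le_powerlt κ (by simpa using mk_Iio_lt w : #(Set.Iio w) < κ)
      _ = κ * κ ^< κ := by simp
      _ ≤ κ ^< κ := (mul_le_max_of_aleph0_le_left hκ).trans (max_le hle le_rfl)
  · refine powerlt_le.2 fun μ hμ => ?_
    have hμ' : μ.ord ∈ Set.Iio κ.ord := ord_lt_ord.2 hμ
    have hmk : #(Set.Iio (Ordinal.ToType.mk ⟨μ.ord, hμ'⟩)) = μ := by
      rw [← Ordinal.card_type (α := Set.Iio _) (· < ·), Ordinal.type_Iio_lt]
      exact (congrArg Ordinal.card (Ordinal.typein_enum _ _)).trans (card_ord μ)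
    refine le_trans (le_of_eq ?_) (le_sum _ (Ordinal.ToType.mk ⟨μ.ord, hμ'⟩))
    simp [hmk]

/-- Supersets of a cofinal set `C` of size `< κ` which, on the complement of `C`, code
the functions `Set.Iio w → W`. -/
theorem exists_incomparable_cofinal_family {κ : Cardinal.{u}} (hκ : ℵ₀ ≤ κ)
    (hcof : κ.ord.cof < κ) :
    ∃ F : (Σ w : κ.ord.ToType, Set.Iio w → κ.ord.ToType) → Set κ.ord.ToType,
      (∀ x, IsCofinal (F x)) ∧ (∀ x, #(F x) < κ) ∧ ∀ x y, F x ⊆ F y → x = y := by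
  obtain ⟨C, hC, hCκ⟩ := Order.exists_cof_eq κ.ord.ToType
  replace hCκ : #C < κ := by
    rw [hCκ]
    simpa using hcof
  have hinf : Infinite κ.ord.ToType := by
    rw [infinite_iff]
    simpa using hκ
  have hcompl : #(Cᶜ : Set κ.ord.ToType) = κ := by
    rw [mk_compl_of_infinite C (by simpa using hCκ), mk_ord_toType]
  obtain ⟨e⟩ : Nonempty (κ.ord.ToType ⊕ κ.ord.ToType × κ.ord.ToType ↪ (Cᶜ : Set κ.ord.ToType)) := by
    rw [← Cardinal.le_def, hcompl]
    simp [mul_eq_self hκ, add_eq_self hκ]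
  let j : κ.ord.ToType ⊕ κ.ord.ToType × κ.ord.ToType → κ.ord.ToType := fun a => e a
  have hj : Function.Injective j := Subtype.val_injective.comp e.injective
  refine ⟨fun x => C ∪ j '' markedGraph x, fun x => hC.mono Set.subset_union_left, fun x => ?_,
    fun x y h => eq_of_markedGraph_subset ?_⟩
  · exact (mk_union_le _ _).trans_lt
      (add_lt_of_lt hκ hCκ (mk_image_le.trans_lt (mk_markedGraph_lt hκ x)))
  · rw [← Set.image_subset_image_iff hj]
    rintro _ ⟨a, ha, rfl⟩
    exact (h (Or.inr ⟨a, ha, rfl⟩)).resolve_left (e a).2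

theorem setSum_le {κ : Cardinal.{u}} (hκ : ℵ₀ ≤ κ) {A : Set Cardinal.{u}}
    (hA : #A ≤ lift.{u + 1} κ) (hle : ∀ ξ ∈ A, ξ ≤ κ) : setSum A ≤ lift.{u + 1} κ :=
  calc
    setSum A ≤ sum fun _ : A => κ := sum_le_sum _ _ fun ξ => hle ξ ξ.2
    _ = #A * lift.{u + 1} κ := by rw [sum_const, lift_id'.{u, u + 1}]
    _ ≤ lift.{u + 1} κ * lift.{u + 1} κ := by gcongr
    _ = lift.{u + 1} κ := mul_eq_self (by simpa using hκ)

theorem le_setSum {κ : Cardinal.{u}} {A : Set Cardinal.{u}}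
    (h : ∀ μ < κ, ∃ ξ ∈ A, μ < ξ) : lift.{u + 1} κ ≤ setSum A := by
  by_contra! hlt
  obtain ⟨μ, hμ, hμA⟩ := lt_lift_iff.1 hlt
  obtain ⟨ξ, hξ, hμξ⟩ := h μ hμ
  have : lift.{u + 1} ξ ≤ setSum A := lift_le_sum (fun η : A => (η : Cardinal.{u})) ⟨ξ, hξ⟩
  rw [← hμA, lift_le] at this
  exact this.not_gt hμξ

/-- The successor cardinals below a fixed point of the aleph function, indexed by a well-order. -/
noncomputable def succAleph (κ : Cardinal.{u}) (w : κ.ord.ToType) : Cardinal.{u} :=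
  Order.succ (ℵ_ (Ordinal.ToType.mk.symm w : Set.Iio κ.ord).1)

theorem succAleph_injective (κ : Cardinal.{u}) : Function.Injective (succAleph κ) := by
  intro v w h
  exact Ordinal.ToType.mk.symm.injective
    (Subtype.ext (aleph.injective (Order.succ_injective h)))

theorem succAleph_le {κ : Cardinal.{u}} (hκ : κ = ℵ_ κ.ord) (w : κ.ord.ToType) :
    succAleph κ w ≤ κ := by
  refine Order.succ_le_of_lt ?_
  conv_rhs => rw [hκ]
  exact aleph_lt_aleph.2 (Ordinal.ToType.mk.symm w).2

theorem exists_lt_succAleph {κ : Cardinal.{u}} (hκ : κ = ℵ_ κ.ord) {D : Set κ.ord.ToType}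
    (hD : IsCofinal D) {μ : Cardinal.{u}} (hμ : μ < κ) : ∃ w ∈ D, μ < succAleph κ w := by
  rcases lt_or_ge μ ℵ₀ with h | h
  · obtain ⟨w, hw, -⟩ := hD (Ordinal.ToType.mk ⟨0, by
      rw [Set.mem_Iio, ← ord_zero, ord_lt_ord]
      exact zero_le.trans_lt hμ⟩)
    exact ⟨w, hw, h.trans_le ((aleph0_le_aleph _).trans (Order.le_succ _))⟩
  · obtain ⟨β, rfl⟩ := mem_range_aleph_iff.2 h
    have hβ : β < κ.ord := by
      rwa [hκ, aleph_lt_aleph] at hμ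
    obtain ⟨w, hw, hβw⟩ := hD (Ordinal.ToType.mk ⟨β, hβ⟩)
    refine ⟨w, hw, Order.lt_succ_of_le (aleph_le_aleph.2 ?_)⟩
    exact (Ordinal.ToType.mk.le_symm_apply (x := ⟨β, hβ⟩)).2 hβw

/-- For singular `κ = ℵ_α` with `max(|α|, ℵ₀) = κ`, there is a family of `κ^{<κ}` pairwise
incomparable small unbounded subsets of `R`. -/
theorem exists_incomparable_small_unbounded_family {α : Ordinal.{u}} (κ : Cardinal.{u})
    (hκ : κ = Cardinal.aleph α) (hlam : max α.card ℵ₀ = κ) (hsing : ¬κ.IsRegular)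
    (n : ℕ → ℕ) (hn : ∀ i, (∑ j ∈ Finset.range i, n j) < n i) :
    ∃ I : Set (Set Cardinal.{u}),
      #I = Cardinal.lift.{u + 1} (κ ^< κ) ∧
      (∀ A ∈ I, A ⊆ setR κ n ∧ #A < Cardinal.lift.{u + 1} κ ∧
        setSum A = Cardinal.lift.{u + 1} κ) ∧
      (∀ A ∈ I, ∀ B ∈ I, A ≠ B → ¬ A ⊆ B) := by
  have hℵ : ℵ₀ ≤ κ := hlam ▸ le_max_right _ _
  have hcof : κ.ord.cof < κ := by
    by_contra! h
    exact hsing ⟨hℵ, h⟩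
  have hα : α = κ.ord := by
    apply le_antisymm
    · rw [hκ, ord_aleph]
      exact Ordinal.le_omega_self α
    · rcases max_choice α.card ℵ₀ with h | h
      · rw [ord_le, ← h, hlam]
      · exact absurd (hlam.symm.trans h ▸ isRegular_aleph0) hsing
  subst hα
  obtain ⟨F, hFcof, hFκ, hF⟩ := exists_incomparable_cofinal_family hℵ hcof
  let G := fun x => succAleph κ '' F x
  have hG : ∀ x y, G x ⊆ G y → x = y := fun x y h =>
    hF x y ((Set.image_subset_image_iff (succAleph_injective κ)).1 h)
  have hGκ : ∀ x, #(G x) < lift.{u + 1} κ := fun x => by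
    have := mk_image_eq_lift (succAleph κ) (F x) (succAleph_injective κ)
    rw [lift_id'.{u, u + 1}] at this
    rw [this]
    exact lift_lt.2 (hFκ x)
  refine ⟨Set.range G, ?_, ?_, ?_⟩
  · rw [← mk_sigma_Iio_arrow hℵ]
    have := mk_range_eq_of_injective (f := G) fun x y h => hG x y h.subset
    rwa [lift_id'.{u, u + 1}] at this
  · rintro _ ⟨x, rfl⟩
    refine ⟨?_, hGκ x, le_antisymm (setSum_le hℵ (hGκ x).le ?_) (le_setSum fun μ hμ => ?_)⟩
    · rintro _ ⟨w, -, rfl⟩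
      exact Or.inr ⟨(aleph0_le_aleph _).trans (Order.le_succ _), succAleph_le hκ w, _, rfl⟩
    · rintro _ ⟨w, -, rfl⟩
      exact succAleph_le hκ w
    · obtain ⟨w, hw, hμw⟩ := exists_lt_succAleph hκ (hFcof x) hμ
      exact ⟨_, ⟨w, hw, rfl⟩, hμw⟩
  · rintro _ ⟨x, rfl⟩ _ ⟨y, rfl⟩ hne h
    exact hne (congrArg G (hG x y h))
end

section
/- Let κ be a singular cardinal with κ = ℵ_α and max(|α|, ℵ₀) = κ, let R = {n_i : i ∈ ω} ∪ {ξ : ξ an infinite successor cardinal, ξ ≤ κ} for a sequence (n_i) of natural numbers with Σ_{j<i} n_j < n_i, and let ξ be a cardinal with cf(κ) ≤ ξ < κ. Then there exists a family I_ξ of pairwise incomparable unbounded subsets of R, each of cardinality ξ, with |I_ξ| = κ^ξ. -/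
open Cardinal

universe u

/-- Lifting a cardinal of a successor universe to a smaller universe does nothing. -/
theorem lift_of_succ_universe (c : Cardinal.{u + 1}) : Cardinal.lift.{u} c = c :=
  lift_id'.{u, u + 1} c

/-- If `κ` is not regular, the infinite cardinals below `κ` are closed under successors. -/
theorem succ_lt_of_not_isRegular {κ μ : Cardinal.{u}} (hκ : ¬κ.IsRegular) (hμ : ℵ₀ ≤ μ)
    (h : μ < κ) : Order.succ μ < κ :=
  (Order.succ_le_of_lt h).lt_of_ne fun e => hκ (e ▸ isRegular_succ hμ)

/-- A singular cardinal is the supremum of `cf κ` many infinite successor cardinals. -/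
theorem exists_cofinal_succ_cardinals {κ : Cardinal.{u}} (hκ : ¬κ.IsRegular) (h0 : ℵ₀ < κ) :
    ∃ C : Set Cardinal.{u}, #C ≤ Cardinal.lift.{u + 1} κ.ord.cof ∧
      (∀ c ∈ C, ℵ₀ ≤ c ∧ c ≤ κ ∧ ∃ μ : Cardinal.{u}, c = Order.succ μ) ∧
      ∀ μ < κ, ∃ c ∈ C, μ < c := by
  obtain ⟨s, hs, hcard⟩ := Order.exists_cof_eq (α := κ.ord.ToType)
  let f : κ.ord.ToType → Cardinal.{u} := fun x =>
    Order.succ (max ℵ₀ (Ordinal.ToType.mk.symm x : Ordinal.{u}).card)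
  refine ⟨f '' s, ?_, ?_, ?_⟩
  · have h := mk_image_le_lift (f := f) (s := s)
    rw [hcard, ← Ordinal.cof_type, Ordinal.type_toType] at h
    simpa [lift_of_succ_universe] using h
  · rintro _ ⟨x, -, rfl⟩
    refine ⟨(le_max_left _ _).trans (Order.le_succ _), ?_, _, rfl⟩
    refine (succ_lt_of_not_isRegular hκ (le_max_left _ _) (max_lt h0 ?_)).le
    exact lt_ord.1 (Ordinal.ToType.mk.symm x).2
  · intro μ hμ
    obtain ⟨x, hx, hle⟩ := hs (Ordinal.ToType.mk ⟨μ.ord, ord_lt_ord.2 hμ⟩)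
    refine ⟨f x, ⟨x, hx, rfl⟩, Order.lt_succ_of_le (le_max_of_le_right ?_)⟩
    rw [← OrderIso.le_symm_apply] at hle
    exact ord_le.1 hle

/-- There are at least `|α|` infinite successor cardinals up to `ℵ_α`. -/
theorem lift_card_le_mk_succ_cardinals (α : Ordinal.{u}) :
    Cardinal.lift.{u + 1} α.card ≤
      #{c : Cardinal.{u} | ℵ₀ ≤ c ∧ c ≤ ℵ_ α ∧ ∃ μ : Cardinal.{u}, c = Order.succ μ} := by
  rw [← mk_Iio_ordinal]
  refine mk_le_of_injective (f := fun o => ⟨Order.succ (ℵ_ o.1), ?_, ?_, _, rfl⟩) ?_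
  · exact (aleph0_le_aleph _).trans (Order.le_succ _)
  · exact Order.succ_le_of_lt (aleph_lt_aleph.2 o.2)
  · intro a b h
    have h' : Order.succ (ℵ_ a.1) = Order.succ (ℵ_ b.1) := congrArg Subtype.val h
    exact Subtype.ext (aleph.injective (Order.succ_injective h'))

/-- A set of at most `κ` cardinals `≤ κ` which is unbounded below `κ` sums to `κ`. -/
theorem setSum_eq_of_cofinal {κ : Cardinal.{u}} (h0 : ℵ₀ ≤ κ) {A : Set Cardinal.{u}}
    (hA : #A ≤ Cardinal.lift.{u + 1} κ) (hle : ∀ c ∈ A, c ≤ κ)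
    (hcof : ∀ μ < κ, ∃ c ∈ A, μ < c) : setSum A = Cardinal.lift.{u + 1} κ := by
  apply le_antisymm
  · calc setSum A ≤ Cardinal.sum fun _ : A => κ := sum_le_sum _ _ fun c => hle c c.2
      _ = #A * Cardinal.lift.{u + 1} κ := by simp [lift_of_succ_universe]
      _ ≤ Cardinal.lift.{u + 1} κ * Cardinal.lift.{u + 1} κ := by gcongr
      _ = Cardinal.lift.{u + 1} κ := mul_eq_self (by simpa using h0)
  · refine le_of_forall_lt fun μ hμ => ?_
    obtain ⟨ν, hν, rfl⟩ := lt_lift_iff.1 hμ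
    obtain ⟨c, hc, hνc⟩ := hcof ν hν
    have h : Cardinal.lift.{u + 1} c ≤ setSum A :=
      lift_le_sum (fun η : A => (η : Cardinal.{u})) ⟨c, hc⟩
    exact (lift_lt.2 hνc).trans_le h

/-- For singular `κ = ℵ_α` with `max(|α|, ℵ₀) = κ` and any cardinal `ξ` with
`cf(κ) ≤ ξ < κ`, there is a family of `κ^ξ` pairwise incomparable unbounded subsets of `R`,
each of cardinality `ξ`. -/
theorem exists_incomparable_unbounded_family_of_card {α : Ordinal.{u}} (κ : Cardinal.{u})
    (hκ : κ = Cardinal.aleph α) (hlam : max α.card ℵ₀ = κ) (hsing : ¬κ.IsRegular)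
    (n : ℕ → ℕ) (hn : ∀ i, (∑ j ∈ Finset.range i, n j) < n i)
    (ξ : Cardinal.{u}) (hcof : (Cardinal.ord κ).cof ≤ ξ) (hξκ : ξ < κ) :
    ∃ I : Set (Set Cardinal.{u}),
      #I = Cardinal.lift.{u + 1} (κ ^ ξ) ∧
      (∀ A ∈ I, A ⊆ setR κ n ∧ #A = Cardinal.lift.{u + 1} ξ ∧
        setSum A = Cardinal.lift.{u + 1} κ) ∧
      (∀ A ∈ I, ∀ B ∈ I, A ≠ B → ¬ A ⊆ B) := by
  have hκ0 : ℵ₀ ≤ κ := hlam ▸ le_max_right _ _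
  have h0 : ℵ₀ < κ := hκ0.lt_of_ne fun e => hsing (e ▸ isRegular_aleph0)
  have hα : α.card = κ := by
    rcases max_choice α.card ℵ₀ with h | h
    · rw [← h, hlam]
    · exact absurd (h.symm.trans hlam) h0.ne
  have hξ0 : ℵ₀ ≤ ξ := by
    refine le_trans (Ordinal.aleph0_le_cof_iff.2 ?_) hcof
    exact Ordinal.one_lt_cof_iff.2 (isSuccLimit_ord hκ0)
  obtain ⟨C, hCcard, hC, hCcof⟩ := exists_cofinal_succ_cardinals hsing h0
  have hCξ : #C ≤ Cardinal.lift.{u + 1} ξ := hCcard.trans (lift_le.2 hcof)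
  set S := {c : Cardinal.{u} | ℵ₀ ≤ c ∧ c ≤ κ ∧ ∃ μ : Cardinal.{u}, c = Order.succ μ} with hS
  have hScard : Cardinal.lift.{u + 1} κ ≤ #S := by
    have h := lift_card_le_mk_succ_cardinals α
    rwa [hα, ← hκ] at h
  have hdiff : Cardinal.lift.{u + 1} κ ≤ #(S \ C : Set Cardinal.{u}) := by
    by_contra! hlt
    refine (hScard.trans (le_mk_sdiff_add_mk S C)).not_gt ?_
    exact add_lt_of_lt (by simpa using hκ0) hlt (hCξ.trans_lt (lift_lt.2 hξκ))
  obtain ⟨e⟩ : Nonempty (ξ.out × κ.out ↪ (S \ C : Set Cardinal.{u})) := by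
    rw [← lift_mk_le']
    have hmul : ξ * κ = κ := mul_eq_right hκ0 hξκ.le (aleph0_pos.trans_le hξ0).ne'
    simpa [← lift_mul, hmul, lift_of_succ_universe] using hdiff
  let G : (ξ.out → κ.out) → Set Cardinal.{u} := fun f =>
    C ∪ Set.range fun i => (e (i, f i) : Cardinal.{u})
  have hGsub : ∀ f g, G f ⊆ G g → f = g := by
    intro f g h
    funext i
    rcases h (Or.inr ⟨i, rfl⟩) with hi | ⟨j, hj⟩
    · exact absurd hi (e (i, f i)).2.2
    · have hp := e.injective (Subtype.ext hj)
      simp only [Prod.mk.injEq] at hp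
      obtain ⟨rfl, h'⟩ := hp
      exact h'.symm
  have hGS : ∀ f, G f ⊆ S := by
    rintro f c (hc | ⟨i, rfl⟩)
    · exact hC c hc
    · exact (e (i, f i)).2.1
  have hGcard : ∀ f, #(G f) = Cardinal.lift.{u + 1} ξ := by
    intro f
    have hinj : Function.Injective fun i => (e (i, f i) : Cardinal.{u}) := fun i j h =>
      congrArg Prod.fst (e.injective (Subtype.ext h))
    have hr := mk_range_eq_of_injective hinj
    rw [lift_of_succ_universe, mk_out] at hr
    apply le_antisymm
    · refine (mk_union_le _ _).trans (add_le_of_le (by simpa using hξ0) hCξ ?_)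
      exact hr.le
    · refine le_trans ?_ (mk_le_mk_of_subset Set.subset_union_right)
      exact hr.ge
  refine ⟨Set.range G, ?_, ?_, ?_⟩
  · have hr := mk_range_eq_of_injective (f := G) fun f g h => hGsub f g h.subset
    simpa [lift_of_succ_universe] using hr
  · rintro _ ⟨f, rfl⟩
    refine ⟨(hGS f).trans Set.subset_union_right, hGcard f, ?_⟩
    refine setSum_eq_of_cofinal hκ0 ((hGcard f).trans_le (lift_le.2 hξκ.le))
      (fun c hc => (hGS f hc).2.1) fun μ hμ => ?_
    obtain ⟨c, hc, h⟩ := hCcof μ hμ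
    exact ⟨c, Or.inl hc, h⟩
  · rintro _ ⟨f, rfl⟩ _ ⟨g, rfl⟩ hne h
    exact hne (congrArg G (hGsub f g h))
end
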